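/- arXiv:1506.06422 — 7 statements merged into one kernel-verified Lean document; each statement's English description precedes it below -/
import Mathlib

section
/- Let (X, 𝒞, h) be a cluster tree with height function, λ ∈ ℝ, and let S, S' ⊆ X be finite nonempty sets such that each of S and S' is connected at level λ in (X, 𝒞, h) and S and S' are separated at level λ in (X, 𝒞, h). Suppose A ∈ 𝒞 is a smallest cluster containing S (i.e., S ⊆ A, and A ⊆ C for every C ∈ 𝒞 with S ⊆ C) and A' ∈ 𝒞 is a smallest cluster containing S'. Then A ∩ A' = ∅. -/
open Set

/-- Height of a cluster: infimum of the height function over the cluster. -/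
noncomputable def clusterHeight {X : Type*} (h : X → ℝ) (C : Set X) : ℝ :=
  sInf (h '' C)

/-- Points `x` and `x'` are connected at level `lam` in the cluster tree `𝒞`
equipped with height function `h`. -/
def connectedAtLevel {X : Type*} (𝒞 : Set (Set X)) (h : X → ℝ) (lam : ℝ) (x x' : X) : Prop :=
  ∃ C ∈ 𝒞, x ∈ C ∧ x' ∈ C ∧ lam ≤ clusterHeight h C

/-- A set `S` is connected at level `lam`: every pair of its points is. -/
def setConnectedAtLevel {X : Type*} (𝒞 : Set (Set X)) (h : X → ℝ) (lam : ℝ) (S : Set X) : Prop :=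
  ∀ x ∈ S, ∀ x' ∈ S, connectedAtLevel 𝒞 h lam x x'

/-- Sets `S` and `S'` are separated at level `lam`. -/
def separatedAtLevel {X : Type*} (𝒞 : Set (Set X)) (h : X → ℝ) (lam : ℝ) (S S' : Set X) : Prop :=
  ∀ s ∈ S, ∀ s' ∈ S', ¬ connectedAtLevel 𝒞 h lam s s'

/-- Merge height of two points in a cluster tree equipped with a height function. -/
noncomputable def treeMergeHeight {X : Type*} (𝒞 : Set (Set X)) (h : X → ℝ) (x x' : X) : ℝ :=
  sSup {r | ∃ C ∈ 𝒞, x ∈ C ∧ x' ∈ C ∧ r = clusterHeight h C}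

/-- `𝒞` is a cluster tree on the set `Y`: `Y ∈ 𝒞`, all clusters are subsets of `Y`,
and any two clusters are nested or disjoint (laminar family). -/
def IsClusterTreeOn {X : Type*} (Y : Set X) (𝒞 : Set (Set X)) : Prop :=
  Y ∈ 𝒞 ∧ (∀ C ∈ 𝒞, C ⊆ Y) ∧ ∀ C ∈ 𝒞, ∀ C' ∈ 𝒞, C ∩ C' = ∅ ∨ C ⊆ C' ∨ C' ⊆ C

/-- `A` is a connected component of the superlevel set `{y | lam ≤ f y}`. -/
def IsCCOfSuplevel {X : Type*} [TopologicalSpace X] (f : X → ℝ) (lam : ℝ) (A : Set X) : Prop :=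
  ∃ x, lam ≤ f x ∧ A = connectedComponentIn {y | lam ≤ f y} x

/-- Merge height of two points in the density cluster tree of `f`. -/
noncomputable def densityMergeHeight {X : Type*} [TopologicalSpace X] (f : X → ℝ)
    (x x' : X) : ℝ :=
  sSup {lam | x' ∈ connectedComponentIn {y | lam ≤ f y} x}

/-- The merge level `μ = inf_{a ∈ A, b ∈ B} m_f(a,b)` of two sets in the density
cluster tree of `f`. -/
noncomputable def densityMergeOf {X : Type*} [TopologicalSpace X] (f : X → ℝ)
    (A B : Set X) : ℝ :=
  sInf (Set.image2 (densityMergeHeight f) A B)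

/-- A finite set of points, each connected to `s` at level `lam`, lies in a single cluster
containing `s` whose height is at least `lam`. -/
lemma exists_cluster_of_finite_of_connectedAtLevel {X : Type*} {𝒞 : Set (Set X)} {h : X → ℝ}
    (hlaminar : ∀ C ∈ 𝒞, ∀ C' ∈ 𝒞, C ∩ C' = ∅ ∨ C ⊆ C' ∨ C' ⊆ C) {lam : ℝ} {s : X}
    (hs : connectedAtLevel 𝒞 h lam s s) {T : Set X} (hT : T.Finite)
    (hconn : ∀ x ∈ T, connectedAtLevel 𝒞 h lam s x) :
    ∃ C ∈ 𝒞, s ∈ C ∧ T ⊆ C ∧ lam ≤ clusterHeight h C := by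
  induction T, hT using Set.Finite.induction_on with
  | empty =>
    obtain ⟨C, hC, hsC, -, hle⟩ := hs
    exact ⟨C, hC, hsC, empty_subset C, hle⟩
  | @insert a T _ _ ih =>
    obtain ⟨C, hC, hsC, hTC, hle⟩ := ih fun x hx => hconn x (mem_insert_of_mem a hx)
    obtain ⟨D, hD, hsD, haD, hle'⟩ := hconn a (mem_insert a T)
    rcases hlaminar C hC D hD with hdisj | hCD | hDC
    · exact (hdisj.subset ⟨hsC, hsD⟩).elim
    · exact ⟨D, hD, hsD, insert_subset haD (hTC.trans hCD), hle'⟩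
    · exact ⟨C, hC, hsC, insert_subset (hDC haD) hTC, hle⟩

/-- If `S` and `S'` are each connected at level `lam` but mutually separated at level
`lam`, then the smallest clusters containing them are disjoint. -/
theorem smallest_clusters_disjoint {X : Type*} (𝒞 : Set (Set X)) (h : X → ℝ)
    (hroot : Set.univ ∈ 𝒞)
    (hlaminar : ∀ C ∈ 𝒞, ∀ C' ∈ 𝒞, C ∩ C' = ∅ ∨ C ⊆ C' ∨ C' ⊆ C)
    (lam : ℝ) (S S' : Set X)
    (hSfin : S.Finite) (hSne : S.Nonempty) (hS'fin : S'.Finite) (hS'ne : S'.Nonempty)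
    (hSconn : setConnectedAtLevel 𝒞 h lam S)
    (hS'conn : setConnectedAtLevel 𝒞 h lam S')
    (hsep : separatedAtLevel 𝒞 h lam S S')
    (A A' : Set X)
    (hA : A ∈ 𝒞 ∧ S ⊆ A ∧ ∀ C ∈ 𝒞, S ⊆ C → A ⊆ C)
    (hA' : A' ∈ 𝒞 ∧ S' ⊆ A' ∧ ∀ C ∈ 𝒞, S' ⊆ C → A' ⊆ C) :
    A ∩ A' = ∅ := by
  obtain ⟨s, hs⟩ := hSne
  obtain ⟨s', hs'⟩ := hS'ne
  obtain ⟨C, hC, hsC, hSC, hle⟩ := exists_cluster_of_finite_of_connectedAtLevel hlaminar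
    (hSconn s hs s hs) hSfin (hSconn s hs)
  obtain ⟨C', hC', hsC', hSC', hle'⟩ := exists_cluster_of_finite_of_connectedAtLevel hlaminar
    (hS'conn s' hs' s' hs') hS'fin (hS'conn s' hs')
  rcases hlaminar C hC C' hC' with hdisj | hsub | hsub
  · exact subset_empty_iff.mp
      ((inter_subset_inter (hA.2.2 C hC hSC) (hA'.2.2 C' hC' hSC')).trans hdisj.subset)
  · exact (hsep s hs s' hs' ⟨C', hC', hsub hsC, hsC', hle'⟩).elim
  · exact (hsep s hs s' hs' ⟨C, hC, hsC, hsub hsC', hle⟩).elim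
end

section
/- Let X be a connected topological space, f : X → ℝ nonnegative and bounded, (X_n) a sequence of finite subsets of X, and for each n let 𝒞_n be a finite cluster tree on X_n equipped with the height function f restricted to X_n. Suppose (minimality): for every λ > 0, every connected component A of {f ≥ λ}, and every δ > 0, there exists N such that for all n ≥ N the set A ∩ X_n is connected at level λ − δ in (X_n, 𝒞_n, f). Suppose (separation): for every λ > 0, any two disjoint connected components A, B of {f ≥ λ}, and every δ > 0, there exists N such that for all n ≥ N the sets A ∩ X_n and B ∩ X_n are separated at level μ + δ in (X_n, 𝒞_n, f), where μ := inf_{a ∈ A, b ∈ B} m_f(a, b). Then the following Hartigan consistency property holds: for every λ > 0 and any two disjoint connected components A, A' of {f ≥ λ} with μ := inf_{a ∈ A, a' ∈ A'} m_f(a, a') < λ, there exists N such that for all n ≥ N with A ∩ X_n and A' ∩ X_n nonempty, the smallest cluster of 𝒞_n containing A ∩ X_n and the smallest cluster of 𝒞_n containing A' ∩ X_n are disjoint. -/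
open Set

theorem clusterHeight_anti {X : Type*} {h : X → ℝ} (h0 : ∀ x, 0 ≤ h x) {C D : Set X}
    (hC : C.Nonempty) (hCD : C ⊆ D) : clusterHeight h D ≤ clusterHeight h C := by
  refine csInf_le_csInf ⟨0, ?_⟩ (hC.image h) (image_mono hCD)
  rintro _ ⟨x, -, rfl⟩
  exact h0 x

/-- In a finite cluster tree, a nonempty set connected at a level is contained in a single
cluster of at least that height. -/
theorem setConnectedAtLevel.exists_cluster {X : Type*} {Y : Set X} {𝒞 : Set (Set X)} {h : X → ℝ}
    {lam : ℝ} {S : Set X} (h𝒞 : IsClusterTreeOn Y 𝒞) (hfin : 𝒞.Finite)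
    (hconn : setConnectedAtLevel 𝒞 h lam S) (hS : S.Nonempty) :
    ∃ C ∈ 𝒞, S ⊆ C ∧ lam ≤ clusterHeight h C := by
  obtain ⟨a, ha⟩ := hS
  have hTfin : {C ∈ 𝒞 | a ∈ C ∧ lam ≤ clusterHeight h C}.Finite := hfin.subset (sep_subset _ _)
  obtain ⟨C₀, hC₀, haC₀, -, hhC₀⟩ := hconn a ha a ha
  obtain ⟨C, ⟨hC, haC, hhC⟩, hmax⟩ := hTfin.exists_maximal ⟨C₀, hC₀, haC₀, hhC₀⟩
  refine ⟨C, hC, fun b hb => ?_, hhC⟩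
  obtain ⟨D, hD, haD, hbD, hhD⟩ := hconn a ha b hb
  rcases h𝒞.2.2 C hC D hD with h1 | h1 | h1
  · exact (eq_empty_iff_forall_notMem.mp h1 a ⟨haC, haD⟩).elim
  · exact hmax ⟨hD, haD, hhD⟩ h1 hbD
  · exact h1 hbD

/-- Minimality and separation imply Hartigan consistency. -/
theorem minimality_and_separation_imply_hartigan {X : Type*} [TopologicalSpace X]
    [ConnectedSpace X] (f : X → ℝ) (hf0 : ∀ x, 0 ≤ f x) (hfbdd : ∃ M, ∀ x, f x ≤ M)
    (Xn : ℕ → Set X) (hXnfin : ∀ n, (Xn n).Finite)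
    (𝒞 : ℕ → Set (Set X)) (h𝒞 : ∀ n, IsClusterTreeOn (Xn n) (𝒞 n))
    (h𝒞fin : ∀ n, (𝒞 n).Finite)
    -- minimality
    (hmin : ∀ lam : ℝ, 0 < lam → ∀ A : Set X, IsCCOfSuplevel f lam A →
      ∀ δ : ℝ, 0 < δ → ∃ N, ∀ n ≥ N,
        setConnectedAtLevel (𝒞 n) f (lam - δ) (A ∩ Xn n))
    -- separation
    (hsep : ∀ lam : ℝ, 0 < lam → ∀ A B : Set X,
      IsCCOfSuplevel f lam A → IsCCOfSuplevel f lam B → A ∩ B = ∅ →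
      ∀ δ : ℝ, 0 < δ → ∃ N, ∀ n ≥ N,
        separatedAtLevel (𝒞 n) f (densityMergeOf f A B + δ) (A ∩ Xn n) (B ∩ Xn n)) :
    -- Hartigan consistency
    ∀ lam : ℝ, 0 < lam → ∀ A A' : Set X,
      IsCCOfSuplevel f lam A → IsCCOfSuplevel f lam A' → A ∩ A' = ∅ →
      densityMergeOf f A A' < lam →
      ∃ N, ∀ n ≥ N, (A ∩ Xn n).Nonempty → (A' ∩ Xn n).Nonempty →
        ∀ An A'n : Set X,
          (An ∈ 𝒞 n ∧ A ∩ Xn n ⊆ An ∧ ∀ C ∈ 𝒞 n, A ∩ Xn n ⊆ C → An ⊆ C) →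
          (A'n ∈ 𝒞 n ∧ A' ∩ Xn n ⊆ A'n ∧ ∀ C ∈ 𝒞 n, A' ∩ Xn n ⊆ C → A'n ⊆ C) →
          An ∩ A'n = ∅ := by
  intro lam hlam A A' hA hA' hdisj hmu
  obtain ⟨δ, hδ, hδle⟩ : ∃ δ : ℝ, 0 < δ ∧ densityMergeOf f A A' + δ ≤ lam - δ :=
    ⟨(lam - densityMergeOf f A A') / 2, by linarith, by linarith⟩
  obtain ⟨N₁, h₁⟩ := hmin lam hlam A hA δ hδ
  obtain ⟨N₂, h₂⟩ := hmin lam hlam A' hA' δ hδ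
  obtain ⟨N₃, h₃⟩ := hsep lam hlam A A' hA hA' hdisj δ hδ
  refine ⟨max N₁ (max N₂ N₃), fun n hn hne hne' An A'n hAn hA'n => ?_⟩
  simp only [ge_iff_le, max_le_iff] at hn
  have height_le : ∀ {S B : Set X}, setConnectedAtLevel (𝒞 n) f (lam - δ) S → S.Nonempty →
      S ⊆ B → (∀ C ∈ 𝒞 n, S ⊆ C → B ⊆ C) → lam - δ ≤ clusterHeight f B := by
    intro S B hconn hS hSB hB
    obtain ⟨C, hC, hSC, hhC⟩ := hconn.exists_cluster (h𝒞 n) (h𝒞fin n) hS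
    exact hhC.trans (clusterHeight_anti hf0 (hS.mono hSB) (hB C hC hSC))
  have hhA := height_le (h₁ n hn.1) hne hAn.2.1 hAn.2.2
  have hhA' := height_le (h₂ n hn.2.1) hne' hA'n.2.1 hA'n.2.2
  obtain ⟨a, ha⟩ := hne
  obtain ⟨a', ha'⟩ := hne'
  have hsepn := h₃ n hn.2.2 a ha a' ha'
  rcases (h𝒞 n).2.2 An hAn.1 A'n hA'n.1 with h | h | h
  · exact h
  · exact absurd ⟨A'n, hA'n.1, h (hAn.2.1 ha), hA'n.2.1 ha', hδle.trans hhA'⟩ hsepn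
  · exact absurd ⟨An, hAn.1, hAn.2.1 ha, h (hA'n.2.1 ha'), hδle.trans hhA⟩ hsepn
end

section
/- Let X be a connected topological space and f : X → ℝ with 0 ≤ f ≤ M for some M ∈ ℝ, such that for every λ the superlevel set {f ≥ λ} has finitely many connected components. Let (X_n) be a sequence of finite subsets of X and let 𝒞_n be a cluster tree on X_n equipped with the height function f restricted to X_n. If for every λ > 0, every connected component A of {f ≥ λ}, and every δ > 0 there exists N such that for all n ≥ N the set A ∩ X_n is connected at level λ − δ in (X_n, 𝒞_n, f) (minimality), then uniform minimality holds: for every δ > 0 there exists N, depending only on δ, such that for all n ≥ N, all λ > 0, and every connected component A of {f ≥ λ}, the set A ∩ X_n is connected at level λ − δ in (X_n, 𝒞_n, f). -/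
open Set

theorem setConnectedAtLevel.mono {X : Type*} {𝒞 : Set (Set X)} {h : X → ℝ} {a b : ℝ}
    {S T : Set X} (hT : setConnectedAtLevel 𝒞 h b T) (hST : S ⊆ T) (hab : a ≤ b) :
    setConnectedAtLevel 𝒞 h a S := fun x hx y hy =>
  let ⟨C, hC, hxC, hyC, hle⟩ := hT x (hST hx) y (hST hy)
  ⟨C, hC, hxC, hyC, hab.trans hle⟩

/-- For a nonnegative height function, the root cluster connects everything at any level `≤ 0`. -/
theorem setConnectedAtLevel_of_le_zero {X : Type*} {Y : Set X} {𝒞 : Set (Set X)} {h : X → ℝ}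
    (h𝒞 : IsClusterTreeOn Y 𝒞) (h0 : ∀ x, 0 ≤ h x) {a : ℝ} (ha : a ≤ 0) :
    setConnectedAtLevel 𝒞 h a Y := fun _ hx _ hy =>
  ⟨Y, h𝒞.1, hx, hy, ha.trans (Real.sInf_nonneg (forall_mem_image.2 fun x _ => h0 x))⟩

theorem IsCCOfSuplevel.exists_superset {X : Type*} [TopologicalSpace X] {f : X → ℝ} {a b : ℝ}
    {A : Set X} (hA : IsCCOfSuplevel f b A) (hab : a ≤ b) :
    ∃ B, IsCCOfSuplevel f a B ∧ A ⊆ B := by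
  obtain ⟨x, hx, rfl⟩ := hA
  exact ⟨_, ⟨x, hab.trans hx, rfl⟩, connectedComponentIn_mono x fun _ hy => hab.trans hy⟩

/-- Under boundedness of `f` and finiteness of the number of connected components of
every superlevel set, minimality implies uniform minimality. -/
theorem minimality_implies_uniform_minimality {X : Type*} [TopologicalSpace X]
    [ConnectedSpace X] (f : X → ℝ) (M : ℝ) (hf0 : ∀ x, 0 ≤ f x) (hfM : ∀ x, f x ≤ M)
    (hfincc : ∀ lam : ℝ, {A : Set X | IsCCOfSuplevel f lam A}.Finite)
    (Xn : ℕ → Set X) (hXnfin : ∀ n, (Xn n).Finite)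
    (𝒞 : ℕ → Set (Set X)) (h𝒞 : ∀ n, IsClusterTreeOn (Xn n) (𝒞 n))
    -- minimality
    (hmin : ∀ lam : ℝ, 0 < lam → ∀ A : Set X, IsCCOfSuplevel f lam A →
      ∀ δ : ℝ, 0 < δ → ∃ N, ∀ n ≥ N,
        setConnectedAtLevel (𝒞 n) f (lam - δ) (A ∩ Xn n)) :
    -- uniform minimality
    ∀ δ : ℝ, 0 < δ → ∃ N, ∀ n ≥ N, ∀ lam : ℝ, 0 < lam →
      ∀ A : Set X, IsCCOfSuplevel f lam A →
        setConnectedAtLevel (𝒞 n) f (lam - δ) (A ∩ Xn n) := by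
  intro δ hδ
  have hε : 0 < δ / 2 := half_pos hδ
  have hgrid : ∀ᶠ n in Filter.atTop, ∀ k ∈ Set.Icc 1 ⌊M / (δ / 2)⌋₊,
      ∀ A ∈ {A : Set X | IsCCOfSuplevel f (k * (δ / 2)) A},
        setConnectedAtLevel (𝒞 n) f (k * (δ / 2) - δ / 2) (A ∩ Xn n) := by
    refine (Filter.eventually_all_finite (Set.finite_Icc _ _)).2 fun k hk => ?_
    refine (Filter.eventually_all_finite (hfincc _)).2 fun A hA => ?_
    have hk0 : (0 : ℝ) < k := by exact_mod_cast hk.1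
    exact Filter.eventually_atTop.2 (hmin _ (mul_pos hk0 hε) A hA _ hε)
  obtain ⟨N, hN⟩ := Filter.eventually_atTop.1 hgrid
  refine ⟨N, fun n hn lam hlam A hA => ?_⟩
  rcases lt_or_ge lam (δ / 2) with hlt | hge
  · exact (setConnectedAtLevel_of_le_zero (h𝒞 n) hf0 (by linarith)).mono inter_subset_right le_rfl
  · have hk1 : 1 ≤ ⌊lam / (δ / 2)⌋₊ := Nat.one_le_floor_iff _ |>.2 ((one_le_div hε).2 hge)
    have hle : (⌊lam / (δ / 2)⌋₊ : ℝ) * (δ / 2) ≤ lam :=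
      (le_div_iff₀ hε).1 (Nat.floor_le (div_pos hlam hε).le)
    have hlt : lam < (⌊lam / (δ / 2)⌋₊ + 1 : ℝ) * (δ / 2) :=
      (div_lt_iff₀ hε).1 (Nat.lt_floor_add_one _)
    have hM : lam ≤ M := by
      obtain ⟨x, hx, -⟩ := hA
      exact hx.trans (hfM x)
    obtain ⟨B, hB, hAB⟩ := hA.exists_superset hle
    exact (hN n hn _ ⟨hk1, Nat.floor_le_floor (by gcongr)⟩ B hB).mono
      (inter_subset_inter_left _ hAB) (by linarith)
end

section
/- Let X be a connected topological space and f : X → ℝ nonnegative and bounded above by M, such that for every λ the superlevel set {f ≥ λ} has finitely many connected components. Let (X_n) be a sequence of finite subsets of X and let 𝒞_n be a cluster tree on X_n equipped with the height function f restricted to X_n. If for every λ > 0, any two disjoint connected components A, B of {f ≥ λ}, and every δ > 0 there exists N such that for all n ≥ N the sets A ∩ X_n and B ∩ X_n are separated at level μ + δ in (X_n, 𝒞_n, f), where μ := inf_{a ∈ A, b ∈ B} m_f(a, b) (separation), then uniform separation holds: for every δ > 0 there exists N, depending only on δ, such that for all n ≥ N, all λ > 0, and any two disjoint connected components A, B of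 {f ≥ λ} with μ := inf_{a ∈ A, b ∈ B} m_f(a, b), the sets A ∩ X_n and B ∩ X_n are separated at level μ + δ in (X_n, 𝒞_n, f). -/
open Set

theorem connectedComponentIn_superlevel_anti {X : Type*} [TopologicalSpace X] (f : X → ℝ)
    {ν lam : ℝ} (h : ν ≤ lam) (x : X) :
    connectedComponentIn {y | lam ≤ f y} x ⊆ connectedComponentIn {y | ν ≤ f y} x :=
  connectedComponentIn_mono x fun _ hy => h.trans hy

theorem IsCCOfSuplevel.eq_connectedComponentIn {X : Type*} [TopologicalSpace X] {f : X → ℝ}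
    {lam : ℝ} {A : Set X} (hA : IsCCOfSuplevel f lam A) {a : X} (ha : a ∈ A) :
    A = connectedComponentIn {y | lam ≤ f y} a := by
  obtain ⟨x, -, rfl⟩ := hA
  exact connectedComponentIn_eq ha

/-- If points of two disjoint components merge at level `ν`, then so do all such points. -/
theorem mem_connectedComponentIn_of_disjoint_components {X : Type*} [TopologicalSpace X]
    {f : X → ℝ} {lam ν : ℝ} {A B : Set X} (hA : IsCCOfSuplevel f lam A)
    (hB : IsCCOfSuplevel f lam B) (hAB : A ∩ B = ∅) {a a' b b' : X} (ha : a ∈ A) (ha' : a' ∈ A)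
    (hb : b ∈ B) (hb' : b' ∈ B) (h : b ∈ connectedComponentIn {y | ν ≤ f y} a) :
    b' ∈ connectedComponentIn {y | ν ≤ f y} a' := by
  have hν : ν ≤ lam := by
    by_contra! hlt
    have hbA : b ∈ A := by
      rw [hA.eq_connectedComponentIn ha]
      exact connectedComponentIn_superlevel_anti f hlt.le a h
    exact (hAB ▸ ⟨hbA, hb⟩ : b ∈ (∅ : Set X))
  rw [hA.eq_connectedComponentIn ha] at ha'
  rw [hB.eq_connectedComponentIn hb] at hb'
  rw [← connectedComponentIn_eq (connectedComponentIn_superlevel_anti f hν a ha'),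
    connectedComponentIn_eq h]
  exact connectedComponentIn_superlevel_anti f hν b hb'

/-- The merge height is constant on pairs of points of two disjoint components. -/
theorem densityMergeOf_eq_densityMergeHeight {X : Type*} [TopologicalSpace X]
    {f : X → ℝ} {lam : ℝ} {A B : Set X} (hA : IsCCOfSuplevel f lam A)
    (hB : IsCCOfSuplevel f lam B) (hAB : A ∩ B = ∅) {a b : X} (ha : a ∈ A) (hb : b ∈ B) :
    densityMergeOf f A B = densityMergeHeight f a b := by
  have himage : Set.image2 (densityMergeHeight f) A B = {densityMergeHeight f a b} := by
    refine Set.eq_singleton_iff_unique_mem.2 ⟨⟨a, ha, b, hb, rfl⟩, ?_⟩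
    rintro _ ⟨a', ha', b', hb', rfl⟩
    unfold densityMergeHeight
    congr 1
    ext ν
    exact ⟨mem_connectedComponentIn_of_disjoint_components hA hB hAB ha' ha hb' hb,
      mem_connectedComponentIn_of_disjoint_components hA hB hAB ha ha' hb hb'⟩
  rw [densityMergeOf, himage, csInf_singleton]

theorem le_densityMergeHeight {X : Type*} [TopologicalSpace X] {f : X → ℝ} {ν : ℝ} {a b : X}
    (h : b ∈ connectedComponentIn {y | ν ≤ f y} a) : ν ≤ densityMergeHeight f a b :=
  le_csSup ⟨f b, fun lam hlam => connectedComponentIn_subset {y | lam ≤ f y} a hlam⟩ h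

theorem densityMergeHeight_nonneg {X : Type*} [TopologicalSpace X] [ConnectedSpace X]
    {f : X → ℝ} (hf0 : ∀ x, 0 ≤ f x) (a b : X) : 0 ≤ densityMergeHeight f a b := by
  apply le_densityMergeHeight
  simp [hf0, connectedComponentIn_univ, PreconnectedSpace.connectedComponent_eq_univ]

theorem clusterHeight_le {X : Type*} {f : X → ℝ} (hf0 : ∀ x, 0 ≤ f x) {C : Set X} {x : X}
    (hx : x ∈ C) : clusterHeight f C ≤ f x :=
  csInf_le ⟨0, by rintro _ ⟨y, -, rfl⟩; exact hf0 y⟩ ⟨x, hx, rfl⟩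

/-- Under boundedness of `f` and finiteness of the number of connected components of
every superlevel set, separation implies uniform separation. -/
theorem separation_implies_uniform_separation {X : Type*} [TopologicalSpace X]
    [ConnectedSpace X] (f : X → ℝ) (M : ℝ) (hf0 : ∀ x, 0 ≤ f x) (hfM : ∀ x, f x ≤ M)
    (hfincc : ∀ lam : ℝ, {A : Set X | IsCCOfSuplevel f lam A}.Finite)
    (Xn : ℕ → Set X) (hXnfin : ∀ n, (Xn n).Finite)
    (𝒞 : ℕ → Set (Set X)) (h𝒞 : ∀ n, IsClusterTreeOn (Xn n) (𝒞 n))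
    -- separation
    (hsep : ∀ lam : ℝ, 0 < lam → ∀ A B : Set X,
      IsCCOfSuplevel f lam A → IsCCOfSuplevel f lam B → A ∩ B = ∅ →
      ∀ δ : ℝ, 0 < δ → ∃ N, ∀ n ≥ N,
        separatedAtLevel (𝒞 n) f (densityMergeOf f A B + δ) (A ∩ Xn n) (B ∩ Xn n)) :
    -- uniform separation
    ∀ δ : ℝ, 0 < δ → ∃ N, ∀ n ≥ N, ∀ lam : ℝ, 0 < lam →
      ∀ A B : Set X, IsCCOfSuplevel f lam A → IsCCOfSuplevel f lam B → A ∩ B = ∅ →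
        separatedAtLevel (𝒞 n) f (densityMergeOf f A B + δ) (A ∩ Xn n) (B ∩ Xn n) := by
  intro δ hδ
  have hgrid : ∀ᶠ n in Filter.atTop, ∀ k ∈ Set.Iic ⌊M / δ⌋₊,
      ∀ A ∈ {A : Set X | IsCCOfSuplevel f (k * δ) A},
      ∀ B ∈ {B : Set X | IsCCOfSuplevel f (k * δ) B}, 0 < k → A ∩ B = ∅ →
        separatedAtLevel (𝒞 n) f (densityMergeOf f A B + δ) (A ∩ Xn n) (B ∩ Xn n) := by
    refine (Filter.eventually_all_finite (Set.finite_Iic _)).2 fun k _ => ?_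
    refine (Filter.eventually_all_finite (hfincc _)).2 fun A hA => ?_
    refine (Filter.eventually_all_finite (hfincc _)).2 fun B hB => ?_
    by_cases hk : 0 < k
    · by_cases hAB : A ∩ B = ∅
      · have hpos : 0 < (k : ℝ) * δ := mul_pos (by exact_mod_cast hk) hδ
        filter_upwards [Filter.eventually_atTop.2 (hsep _ hpos A B hA hB hAB δ hδ)]
          with n hn _ _ using hn
      · exact Filter.Eventually.of_forall fun _ _ h => absurd h hAB
    · exact Filter.Eventually.of_forall fun _ h => absurd h hk
  obtain ⟨N, hN⟩ := Filter.eventually_atTop.1 hgrid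
  refine ⟨N, fun n hn lam _ A B hA hB hAB s hs s' hs' hconn => ?_⟩
  rw [densityMergeOf_eq_densityMergeHeight hA hB hAB hs.1 hs'.1] at hconn
  obtain ⟨C, -, hsC, hs'C, hC⟩ := id hconn
  set μ := densityMergeHeight f s s' with hμ
  have hμ0 : 0 ≤ μ := densityMergeHeight_nonneg hf0 s s'
  have hlt : μ < (⌊μ / δ⌋₊ + 1 : ℕ) * δ := by
    rw [← div_lt_iff₀ hδ]
    exact_mod_cast Nat.lt_floor_add_one (μ / δ)
  have hle : (⌊μ / δ⌋₊ + 1 : ℕ) * δ ≤ μ + δ := by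
    have := (le_div_iff₀ hδ).1 (Nat.floor_le (div_nonneg hμ0 hδ.le))
    push_cast
    linarith
  set k := ⌊μ / δ⌋₊ + 1 with hk
  have hks : k * δ ≤ f s := hle.trans (hC.trans (clusterHeight_le hf0 hsC))
  have hks' : k * δ ≤ f s' := hle.trans (hC.trans (clusterHeight_le hf0 hs'C))
  have hkM : k ≤ ⌊M / δ⌋₊ := Nat.le_floor ((le_div_iff₀ hδ).2 (hks.trans (hfM s)))
  have hAs : IsCCOfSuplevel f (k * δ) (connectedComponentIn {y | k * δ ≤ f y} s) :=
    ⟨s, hks, rfl⟩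
  have hBs : IsCCOfSuplevel f (k * δ) (connectedComponentIn {y | k * δ ≤ f y} s') :=
    ⟨s', hks', rfl⟩
  have hsA : s ∈ connectedComponentIn {y | k * δ ≤ f y} s := mem_connectedComponentIn hks
  have hsB : s' ∈ connectedComponentIn {y | k * δ ≤ f y} s' := mem_connectedComponentIn hks'
  have hdisj : connectedComponentIn {y | k * δ ≤ f y} s ∩
      connectedComponentIn {y | k * δ ≤ f y} s' = ∅ := by
    refine Set.eq_empty_of_forall_notMem fun z hz => hlt.not_ge (le_densityMergeHeight ?_)
    rwa [connectedComponentIn_eq hz.1, ← connectedComponentIn_eq hz.2]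
  refine hN n hn k hkM _ hAs _ hBs (Nat.succ_pos _) hdisj s ⟨hsA, hs.2⟩ s' ⟨hsB, hs'.2⟩ ?_
  rwa [densityMergeOf_eq_densityMergeHeight hAs hBs hdisj hsA hsB]
end

section
/- Let X be a connected topological space and let f, f̃ : X → ℝ both be nonnegative and bounded, with δ := sup_{y ∈ X} |f(y) − f̃(y)| finite. Then for all x, x' ∈ X, |m_f(x, x') − m_{f̃}(x, x')| ≤ δ. Consequently, the merge distortion distance between the density cluster trees of f and of f̃ with respect to the identity correspondence on X is at most ‖f − f̃‖_∞. -/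
open Set

/-- The levels at which two points lie in one superlevel component are bounded above. -/
theorem bddAbove_mergeLevels {X : Type*} [TopologicalSpace X] (f : X → ℝ) (x x' : X) :
    BddAbove {lam | x' ∈ connectedComponentIn {y | lam ≤ f y} x} :=
  ⟨f x, fun lam h ↦
    (connectedComponentIn_nonempty_iff (F := {y | lam ≤ f y})).1 ⟨x', h⟩⟩

/-- Any lower bound of `f` on a connected space is a level at which all points are merged. -/
theorem mem_connectedComponentIn_of_forall_le {X : Type*} [TopologicalSpace X] [ConnectedSpace X]
    {f : X → ℝ} {lam : ℝ} (hf : ∀ y, lam ≤ f y) (x x' : X) :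
    x' ∈ connectedComponentIn {y | lam ≤ f y} x := by
  have h : {y | lam ≤ f y} = univ := eq_univ_of_forall hf
  simp [h, connectedComponentIn_univ, PreconnectedSpace.connectedComponent_eq_univ]

/-- If `f` is bounded below and `f ≤ g + δ`, the merge heights of `f` exceed those of `g` by
at most `δ`. -/
theorem densityMergeHeight_le_add {X : Type*} [TopologicalSpace X] [ConnectedSpace X]
    {f g : X → ℝ} {c δ : ℝ} (hf : ∀ y, c ≤ f y) (hfg : ∀ y, f y ≤ g y + δ) (x x' : X) :
    densityMergeHeight f x x' ≤ densityMergeHeight g x x' + δ := by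
  refine csSup_le ⟨c, mem_connectedComponentIn_of_forall_le hf x x'⟩ fun lam hlam ↦ ?_
  have hsub : {y | lam ≤ f y} ⊆ {y | lam - δ ≤ g y} := fun y hy ↦
    sub_le_iff_le_add.2 (le_trans hy (hfg y))
  exact sub_le_iff_le_add.1 <|
    le_csSup (bddAbove_mergeLevels g x x') (connectedComponentIn_mono x hsub hlam)

/-- `L∞`-stability of the density cluster tree: if `|f - f̃| ≤ δ` pointwise, then all
merge heights differ by at most `δ`, hence the merge distortion distance between
the density cluster trees of `f` and `f̃` (identity correspondence) is at most
`‖f - f̃‖_∞`. -/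
theorem densityMergeHeight_stability {X : Type*} [TopologicalSpace X] [ConnectedSpace X]
    (f g : X → ℝ)
    (hf0 : ∀ x, 0 ≤ f x) (hfbdd : ∃ M, ∀ x, f x ≤ M)
    (hg0 : ∀ x, 0 ≤ g x) (hgbdd : ∃ M, ∀ x, g x ≤ M)
    (δ : ℝ) (hδ : ∀ y, |f y - g y| ≤ δ) :
    ∀ x x' : X, |densityMergeHeight f x x' - densityMergeHeight g x x'| ≤ δ := by
  intro x x'
  have hfg (y : X) : f y ≤ g y + δ := by linarith [(abs_le.1 (hδ y)).2]
  have hgf (y : X) : g y ≤ f y + δ := by linarith [(abs_le.1 (hδ y)).1]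
  rw [abs_sub_le_iff]
  exact ⟨sub_le_iff_le_add'.2 (densityMergeHeight_le_add hf0 hfg x x'),
    sub_le_iff_le_add'.2 (densityMergeHeight_le_add hg0 hgf x x')⟩
end

section
/- Let 𝒞 be a cluster tree on a set X, and let f₁, f₂ : X → ℝ be two bounded height functions with δ := sup_{y ∈ X} |f₁(y) − f₂(y)|. For i = 1, 2 let m_i(x, x') := sup{ inf_{y ∈ C} f_i(y) : C ∈ 𝒞, x ∈ C, x' ∈ C } and define the tree distance d_i(x, x') := f_i(x) + f_i(x') − 2 m_i(x, x'). Then for all x, x' ∈ X, |d₁(x, x') − d₂(x, x')| ≤ 4δ. -/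
open Set

theorem bddBelow_image_of_abs_le {X : Type*} {f : X → ℝ} (hf : ∃ M, ∀ x, |f x| ≤ M)
    (C : Set X) : BddBelow (f '' C) := by
  obtain ⟨M, hM⟩ := hf
  refine ⟨-M, ?_⟩
  rintro _ ⟨y, -, rfl⟩
  exact (abs_le.mp (hM y)).1

theorem clusterHeight_le_add {X : Type*} {f g : X → ℝ} {C : Set X} {δ : ℝ}
    (hf : BddBelow (f '' C)) (hC : C.Nonempty) (h : ∀ y ∈ C, f y ≤ g y + δ) :
    clusterHeight f C ≤ clusterHeight g C + δ := by
  rw [← sub_le_iff_le_add]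
  refine le_csInf (hC.image g) ?_
  rintro _ ⟨y, hy, rfl⟩
  have := csInf_le hf (mem_image_of_mem f hy)
  have := h y hy
  unfold clusterHeight
  linarith

theorem clusterHeight_le_treeMergeHeight {X : Type*} {𝒞 : Set (Set X)} {f : X → ℝ}
    (hf : ∃ M, ∀ x, |f x| ≤ M) {C : Set X} (hC : C ∈ 𝒞) {x x' : X} (hx : x ∈ C)
    (hx' : x' ∈ C) : clusterHeight f C ≤ treeMergeHeight 𝒞 f x x' := by
  refine le_csSup ⟨f x, ?_⟩ ⟨C, hC, hx, hx', rfl⟩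
  rintro _ ⟨D, -, hxD, -, rfl⟩
  exact csInf_le (bddBelow_image_of_abs_le hf D) (mem_image_of_mem f hxD)

theorem treeMergeHeight_le_add {X : Type*} {𝒞 : Set (Set X)} (hroot : Set.univ ∈ 𝒞)
    {f g : X → ℝ} (hf : ∃ M, ∀ x, |f x| ≤ M) (hg : ∃ M, ∀ x, |g x| ≤ M) {δ : ℝ}
    (h : ∀ y, f y ≤ g y + δ) (x x' : X) :
    treeMergeHeight 𝒞 f x x' ≤ treeMergeHeight 𝒞 g x x' + δ := by
  refine csSup_le ⟨_, univ, hroot, mem_univ x, mem_univ x', rfl⟩ ?_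
  rintro _ ⟨C, hC, hx, hx', rfl⟩
  have := clusterHeight_le_add (bddBelow_image_of_abs_le hf C) ⟨x, hx⟩ fun y _ => h y
  have := clusterHeight_le_treeMergeHeight hg hC hx hx'
  linarith

/-- `L∞`-stability of the tree distance `d_i(x,x') = f_i(x) + f_i(x') - 2 m_i(x,x')` of
a fixed cluster tree w.r.t. its height function: if `|f₁ - f₂| ≤ δ` pointwise, then
the tree distances differ by at most `4δ`. -/
theorem tree_distance_stability {X : Type*} (𝒞 : Set (Set X))
    (hroot : Set.univ ∈ 𝒞)
    (hlaminar : ∀ C ∈ 𝒞, ∀ C' ∈ 𝒞, C ∩ C' = ∅ ∨ C ⊆ C' ∨ C' ⊆ C)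
    (f₁ f₂ : X → ℝ)
    (hb1 : ∃ M, ∀ x, |f₁ x| ≤ M) (hb2 : ∃ M, ∀ x, |f₂ x| ≤ M)
    (δ : ℝ) (hδ : ∀ y, |f₁ y - f₂ y| ≤ δ) :
    ∀ x x' : X,
      |(f₁ x + f₁ x' - 2 * treeMergeHeight 𝒞 f₁ x x') -
       (f₂ x + f₂ x' - 2 * treeMergeHeight 𝒞 f₂ x x')| ≤ 4 * δ := by
  intro x x'
  have h12 := treeMergeHeight_le_add hroot hb1 hb2
    (fun y => by linarith [(abs_le.mp (hδ y)).2]) x x'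
  have h21 := treeMergeHeight_le_add hroot hb2 hb1
    (fun y => by linarith [(abs_le.mp (hδ y)).1]) x x'
  have hx := abs_le.mp (hδ x)
  have hx' := abs_le.mp (hδ x')
  rw [abs_le]
  constructor <;> linarith [hx.1, hx.2, hx'.1, hx'.2]
end

section
/- Let d ≥ 1 be an integer, c > 0, λ > 0, 0 < ε < 2λ, C > 0, and let n ≥ 2 and k ≥ 1 be integers with k ≥ (8Cλ/ε)² · d · log n. Let v_d be the Lebesgue measure of the unit ball in ℝ^d and let r̃ > 0 be defined by v_d r̃^d (λ − ε/2) = k/n + (C/n)√(k d log n), and assume r̃ c ≤ ε/4. Let f : ℝ^d → ℝ be a nonnegative measurable c-Lipschitz function and let x ∈ ℝ^d satisfy ∫_{B(x, r̃)} f dμ > k/n − (C/n)√(k d log n), where μ is Lebesgue measure and B(x, r̃) the closed Euclidean ball of radius r̃ about x. Then f(x) > λ − ε. -/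
open MeasureTheory

/-- A `c`-Lipschitz function integrates over a closed ball of radius `r` to at most the volume of
the ball times its value at the centre plus `c * r`. -/
theorem setIntegral_closedBall_le_of_lipschitz {d : ℕ} {c r : ℝ} (hc : 0 ≤ c)
    (hr : 0 ≤ r) {f : EuclideanSpace ℝ (Fin d) → ℝ}
    (hlip : ∀ y z, |f y - f z| ≤ c * dist y z) (x : EuclideanSpace ℝ (Fin d)) :
    ∫ y in Metric.closedBall x r, f y ≤
      (volume (Metric.closedBall (0 : EuclideanSpace ℝ (Fin d)) 1)).toReal * r ^ d *
        (f x + c * r) := by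
  have hcont : Continuous f := by
    refine (LipschitzWith.of_dist_le_mul (K := c.toNNReal) fun y z => ?_).continuous
    rw [Real.dist_eq, Real.coe_toNNReal c hc]
    exact hlip y z
  have hvol : volume.real (Metric.closedBall x r) =
      (volume (Metric.closedBall (0 : EuclideanSpace ℝ (Fin d)) 1)).toReal * r ^ d := by
    rw [Measure.real, Measure.addHaar_closedBall' volume x hr, ENNReal.toReal_mul,
      finrank_euclideanSpace_fin, ENNReal.toReal_ofReal (by positivity), mul_comm]
  have hfin : volume (Metric.closedBall x r) ≠ ⊤ := measure_closedBall_lt_top.ne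
  have hle : ∫ y in Metric.closedBall x r, f y ≤
      ∫ _ in Metric.closedBall x r, (f x + c * r) := by
    refine setIntegral_mono_on (hcont.continuousOn.integrableOn_compact
      (isCompact_closedBall x r)) (integrableOn_const hfin) measurableSet_closedBall
      fun y hy => ?_
    have h1 := (abs_le.mp (hlip y x)).2
    have h2 := mul_le_mul_of_nonneg_left (Metric.mem_closedBall.mp hy) hc
    linarith
  rwa [setIntegral_const, hvol, smul_eq_mul] at hle

/-- Deterministic core of the lemma on robust single linkage: any point `x` whose ball
`B(x, r̃)` (with `r̃` chosen so that `v_d r̃ᵈ (λ - ε/2) = k/n + (C/n)√(k d log n)`)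
carries empirical mass greater than `k/n - (C/n)√(k d log n)` must have density
`f(x) > λ - ε`. -/
theorem robust_single_linkage_density_lower_bound
    (d : ℕ) (hd : 1 ≤ d) (c lam ε C : ℝ)
    (hc : 0 < c) (hlam : 0 < lam) (hε0 : 0 < ε) (hε : ε < 2 * lam) (hC : 0 < C)
    (n k : ℕ) (hn : 2 ≤ n) (hk1 : 1 ≤ k)
    (hk : (8 * C * lam / ε) ^ 2 * (d : ℝ) * Real.log n ≤ (k : ℝ))
    (r : ℝ) (hr : 0 < r)
    (hrdef : (volume (Metric.closedBall (0 : EuclideanSpace ℝ (Fin d)) 1)).toReal *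
        r ^ d * (lam - ε / 2) =
        (k : ℝ) / n + (C / n) * Real.sqrt ((k : ℝ) * d * Real.log n))
    (hrc : r * c ≤ ε / 4)
    (f : EuclideanSpace ℝ (Fin d) → ℝ)
    (hf0 : ∀ y, 0 ≤ f y) (hfm : Measurable f)
    (hlip : ∀ y z, |f y - f z| ≤ c * dist y z)
    (x : EuclideanSpace ℝ (Fin d))
    (hx : (k : ℝ) / n - (C / n) * Real.sqrt ((k : ℝ) * d * Real.log n) <
      ∫ y in Metric.closedBall x r, f y) :
    lam - ε < f x := by
  have hint := hx.trans_le (setIntegral_closedBall_le_of_lipschitz hc.le hr.le hlip x)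
  have hn0 : (0 : ℝ) < n := by positivity
  have hdev : 8 * lam * (C / n * Real.sqrt (k * d * Real.log n)) ≤ ε * (k / n) := by
    have hsqrt : Real.sqrt (k * d * Real.log n) ≤ ε * k / (8 * C * lam) := by
      apply Real.sqrt_le_iff.mpr ⟨by positivity, ?_⟩
      have hk' := mul_le_mul_of_nonneg_left hk (Nat.cast_nonneg (α := ℝ) k)
      rw [div_pow, le_div_iff₀ (by positivity)]
      rw [div_pow] at hk'
      field_simp at hk'
      nlinarith
    rw [le_div_iff₀ (by positivity)] at hsqrt
    have := div_le_div_of_nonneg_right hsqrt hn0.le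
    calc _ = Real.sqrt (k * d * Real.log n) * (8 * C * lam) / n := by ring
      _ ≤ ε * k / n := this
      _ = _ := by ring
  set V := (volume (Metric.closedBall (0 : EuclideanSpace ℝ (Fin d)) 1)).toReal * r ^ d
  set S := C / n * Real.sqrt (k * d * Real.log n)
  have hV : 0 ≤ V := by positivity
  have hS : 0 ≤ S := by positivity
  by_contra! hfx
  have hupper : V * (f x + c * r) ≤ V * (lam - 3 * ε / 4) :=
    mul_le_mul_of_nonneg_left (by linarith) hV
  have hVS : ε * V < 8 * S := by linarith
  have hlamVS := mul_lt_mul_of_pos_left hVS hlam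
  have hmass : (k : ℝ) / n = V * (lam - ε / 2) - S := by linarith
  rw [hmass] at hdev
  nlinarith [mul_nonneg hε0.le hS, mul_nonneg (sq_nonneg ε) hV]
end
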